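/- arXiv:2011.08553 — 10 statements merged into one kernel-verified Lean document; each statement's English description precedes it below -/
import Mathlib

section
/- For every fixed opponent action a₂ ∈ ℝ^N with a₂_n ≥ 0 for all n, the map a₁ ↦ u₁(a₁, a₂) is concave on the convex set {a₁ ∈ ℝ^N : a₁_n ≥ 0 for all n}; likewise, for every fixed a₁ ∈ ℝ^N with a₁_n ≥ 0 for all n, the map a₂ ↦ u₂(a₁, a₂) is concave on {a₂ ∈ ℝ^N : a₂_n ≥ 0 for all n}. (Paper's Lemma 1.) -/
/-- The map `t ↦ 1 - c / (s + t)` is concave on `[0, ∞)` when `0 ≤ c` and `0 < s`. -/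
theorem concaveOn_one_sub_div_add {c s : ℝ} (hc : 0 ≤ c) (hs : 0 < s) :
    ConcaveOn ℝ (Set.Ici 0) (fun t : ℝ => 1 - c / (s + t)) := by
  refine ⟨convex_Ici 0, fun x hx y hy a b ha hb hab => ?_⟩
  have hx' : s + x ∈ Set.Ioi (0 : ℝ) := add_pos_of_pos_of_nonneg hs hx
  have hy' : s + y ∈ Set.Ioi (0 : ℝ) := add_pos_of_pos_of_nonneg hs hy
  have h := (convexOn_zpow (𝕜 := ℝ) (-1)).2 hx' hy' ha hb hab
  have hcomb : a * (s + x) + b * (s + y) = s + (a * x + b * y) := by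
    linear_combination s * hab
  simp only [smul_eq_mul, zpow_neg_one, hcomb] at h
  simp only [smul_eq_mul, div_eq_mul_inv]
  linear_combination c * h + hab

/-- A nonnegative combination of concave functions of the coordinates, minus a linear cost, is
concave on the nonnegative orthant. -/
theorem concaveOn_mul_sum_sub_mul_sum {ι : Type*} [Fintype ι] {ρ : ι → ℝ} (hρ : ∀ n, 0 ≤ ρ n)
    {γ : ℝ} (hγ : 0 ≤ γ) (l : ℝ) {g : ι → ℝ → ℝ} (hg : ∀ n, ConcaveOn ℝ (Set.Ici 0) (g n)) :
    ConcaveOn ℝ {a : ι → ℝ | ∀ n, 0 ≤ a n}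
      (fun a => γ * ∑ n, ρ n * g n (a n) - l * ∑ n, a n) := by
  refine ⟨fun x hx y hy a b ha hb _ n =>
    add_nonneg (mul_nonneg ha (hx n)) (mul_nonneg hb (hy n)), fun x hx y hy a b ha hb hab => ?_⟩
  have h : ∑ n, (a * (ρ n * g n (x n)) + b * (ρ n * g n (y n))) ≤
      ∑ n, ρ n * g n (a * x n + b * y n) := by
    refine Finset.sum_le_sum fun n _ => ?_
    have hn := (hg n).2 (hx n) (hy n) ha hb hab
    simp only [smul_eq_mul] at hn
    linear_combination mul_le_mul_of_nonneg_left hn (hρ n)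
  simp only [Finset.sum_add_distrib, ← Finset.mul_sum] at h
  simp only [smul_eq_mul, Pi.add_apply, Pi.smul_apply, Finset.sum_add_distrib, ← Finset.mul_sum]
  linear_combination γ * h

/-- Paper's Lemma 1: for fixed nonnegative opponent action, each firm's utility is
concave in its own action on the nonnegative orthant. -/
theorem stmt_0 (N : ℕ) (hN : 1 ≤ N)
    (ρ x₀ : Fin N → ℝ) (hρ : ∀ n, 0 < ρ n) (hx₀ : ∀ n, 0 < x₀ n ∧ x₀ n < 1)
    (γ₁ γ₂ lam₁ lam₂ : ℝ) (hγ₁ : 0 < γ₁) (hγ₂ : 0 < γ₂) (hlam₁ : 0 ≤ lam₁) (hlam₂ : 0 ≤ lam₂)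
    (φ : ℝ → ℝ → ℝ → ℝ) (hφ : ∀ x a a', φ x a a' = (x + a) / (1 + a + a'))
    (u₁ u₂ : (Fin N → ℝ) → (Fin N → ℝ) → ℝ)
    (hu₁ : ∀ a₁ a₂, u₁ a₁ a₂ =
      γ₁ * ∑ n, ρ n * φ (x₀ n) (a₁ n) (a₂ n) - lam₁ * ∑ n, a₁ n)
    (hu₂ : ∀ a₁ a₂, u₂ a₁ a₂ =
      γ₂ * ∑ n, ρ n * (1 - φ (x₀ n) (a₁ n) (a₂ n)) - lam₂ * ∑ n, a₂ n) :
    (∀ a₂ : Fin N → ℝ, (∀ n, 0 ≤ a₂ n) →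
      ConcaveOn ℝ {a₁ : Fin N → ℝ | ∀ n, 0 ≤ a₁ n} (fun a₁ => u₁ a₁ a₂)) ∧
    (∀ a₁ : Fin N → ℝ, (∀ n, 0 ≤ a₁ n) →
      ConcaveOn ℝ {a₂ : Fin N → ℝ | ∀ n, 0 ≤ a₂ n} (fun a₂ => u₂ a₁ a₂)) := by
  constructor
  · intro a₂ ha₂
    simp only [hu₁]
    refine concaveOn_mul_sum_sub_mul_sum (g := fun n t => φ (x₀ n) t (a₂ n))
      (fun n => (hρ n).le) hγ₁.le lam₁ fun n => ?_
    have h := ha₂ n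
    obtain ⟨-, hx⟩ := hx₀ n
    refine (concaveOn_one_sub_div_add (c := 1 + a₂ n - x₀ n) (s := 1 + a₂ n)
      (by linarith) (by linarith)).congr fun t ht => ?_
    have ht' : 0 ≤ t := ht
    have h₁ : 1 + a₂ n + t ≠ 0 := by positivity
    have h₂ : 1 + t + a₂ n ≠ 0 := by positivity
    simp only [hφ]
    field_simp
    ring
  · intro a₁ ha₁
    simp only [hu₂]
    refine concaveOn_mul_sum_sub_mul_sum (g := fun n t => 1 - φ (x₀ n) (a₁ n) t)
      (fun n => (hρ n).le) hγ₂.le lam₂ fun n => ?_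
    simp only [hφ]
    have h := ha₁ n
    exact concaveOn_one_sub_div_add (add_nonneg (hx₀ n).1.le h) (by linarith)
end

section
/- For every fixed a₂ ∈ ℝ^N with a₂_n ≥ 0 for all n, there exists exactly one a₁* ∈ A₁ such that u₁(a₁*, a₂) ≥ u₁(a₁, a₂) for all a₁ ∈ A₁; i.e., the best response of Firm 1 to any opponent action is a singleton. (Used in the paper to turn the best-response differential inclusion into a differential equation.) -/
/-- The midpoint defect of the campaign map, in closed form. -/
theorem campaign_midpoint_defect {x a b c : ℝ} (ha : 0 ≤ a) (hb : 0 ≤ b) (hc : 0 ≤ c) :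
    2 * ((x + (a + b) / 2) / (1 + (a + b) / 2 + c)) - (x + a) / (1 + a + c)
        - (x + b) / (1 + b + c) =
      (1 + c - x) * (a - b) ^ 2 / ((1 + a + c) * (1 + b + c) * (2 + a + b + 2 * c)) := by
  have h₁ : 1 + a + c ≠ 0 := by positivity
  have h₂ : 1 + b + c ≠ 0 := by positivity
  have h₃ : 2 + a + b + 2 * c ≠ 0 := by positivity
  have h₄ : (x + (a + b) / 2) / (1 + (a + b) / 2 + c) =
      (2 * x + a + b) / (2 + a + b + 2 * c) := by
    rw [div_eq_div_iff (by positivity) h₃]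
    ring
  rw [h₄]
  field_simp
  ring

theorem campaign_add_le_two_mul_midpoint {x a b c : ℝ} (hx : x < 1) (ha : 0 ≤ a) (hb : 0 ≤ b)
    (hc : 0 ≤ c) :
    (x + a) / (1 + a + c) + (x + b) / (1 + b + c) ≤
      2 * ((x + (a + b) / 2) / (1 + (a + b) / 2 + c)) := by
  have h := campaign_midpoint_defect (x := x) ha hb hc
  have hk : 0 ≤ 1 + c - x := by linarith
  have : 0 ≤ (1 + c - x) * (a - b) ^ 2 /
      ((1 + a + c) * (1 + b + c) * (2 + a + b + 2 * c)) := by positivity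
  linarith

theorem campaign_add_lt_two_mul_midpoint {x a b c : ℝ} (hx : x < 1) (ha : 0 ≤ a) (hb : 0 ≤ b)
    (hc : 0 ≤ c) (hab : a ≠ b) :
    (x + a) / (1 + a + c) + (x + b) / (1 + b + c) <
      2 * ((x + (a + b) / 2) / (1 + (a + b) / 2 + c)) := by
  have h := campaign_midpoint_defect (x := x) ha hb hc
  have hk : 0 < 1 + c - x := by linarith
  have hd : a - b ≠ 0 := sub_ne_zero.mpr hab
  have : 0 < (1 + c - x) * (a - b) ^ 2 /
      ((1 + a + c) * (1 + b + c) * (2 + a + b + 2 * c)) := by positivity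
  linarith

/-- The best response of Firm 1 to any fixed nonnegative opponent action is a
singleton: there is exactly one maximizer of u₁(·, a₂) over A₁. -/
theorem stmt_2 (N : ℕ) (hN : 1 ≤ N)
    (ρ x₀ : Fin N → ℝ) (hρ : ∀ n, 0 < ρ n) (hx₀ : ∀ n, 0 < x₀ n ∧ x₀ n < 1)
    (γ₁ γ₂ lam₁ lam₂ : ℝ) (hγ₁ : 0 < γ₁) (hγ₂ : 0 < γ₂) (hlam₁ : 0 ≤ lam₁) (hlam₂ : 0 ≤ lam₂)
    (b₁ B₁ b₂ B₂ : ℝ) (hb₁ : 0 ≤ b₁) (hB₁ : b₁ ≤ B₁) (hb₂ : 0 ≤ b₂) (hB₂ : b₂ ≤ B₂)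
    (A₁ : Set (Fin N → ℝ))
    (hA₁ : A₁ = {a : Fin N → ℝ | (∀ n, 0 ≤ a n ∧ a n ≤ b₁) ∧ ∑ n, a n ≤ B₁})
    (φ : ℝ → ℝ → ℝ → ℝ) (hφ : ∀ x a a', φ x a a' = (x + a) / (1 + a + a'))
    (u₁ : (Fin N → ℝ) → (Fin N → ℝ) → ℝ)
    (hu₁ : ∀ a₁ a₂, u₁ a₁ a₂ =
      γ₁ * ∑ n, ρ n * φ (x₀ n) (a₁ n) (a₂ n) - lam₁ * ∑ n, a₁ n)
    (a₂ : Fin N → ℝ) (ha₂ : ∀ n, 0 ≤ a₂ n) :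
    ∃! a₁star : Fin N → ℝ, a₁star ∈ A₁ ∧ ∀ a₁ ∈ A₁, u₁ a₁ a₂ ≤ u₁ a₁star a₂ := by
  obtain rfl : φ = fun x a a' => (x + a) / (1 + a + a') := by
    funext x a a'
    exact hφ x a a'
  subst hA₁
  simp only at hu₁
  have hcompact : IsCompact
      {a : Fin N → ℝ | (∀ n, 0 ≤ a n ∧ a n ≤ b₁) ∧ ∑ n, a n ≤ B₁} := by
    have hset : {a : Fin N → ℝ | (∀ n, 0 ≤ a n ∧ a n ≤ b₁) ∧ ∑ n, a n ≤ B₁} =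
        Set.univ.pi (fun _ => Set.Icc 0 b₁) ∩ {a | ∑ n, a n ≤ B₁} := by
      ext a
      simp only [Set.mem_ofPred_eq, Set.mem_inter_iff, Set.mem_univ_pi, Set.mem_Icc]
    rw [hset]
    exact (isCompact_univ_pi fun _ => isCompact_Icc).inter_right
      (isClosed_le (by fun_prop) continuous_const)
  have hcont : ContinuousOn (fun a => u₁ a a₂)
      {a : Fin N → ℝ | (∀ n, 0 ≤ a n ∧ a n ≤ b₁) ∧ ∑ n, a n ≤ B₁} := by
    simp only [hu₁]
    refine ContinuousOn.sub (continuousOn_const.mul (continuousOn_finsetSum _ fun n _ =>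
      continuousOn_const.mul (ContinuousOn.div (by fun_prop) (by fun_prop) ?_))) (by fun_prop)
    rintro a ⟨ha, -⟩
    have := (ha n).1
    have := ha₂ n
    positivity
  obtain ⟨a, ha, hmax⟩ := hcompact.exists_isMaxOn
    ⟨0, by simpa using ⟨fun _ => hb₁, hb₁.trans hB₁⟩⟩ hcont
  refine ⟨a, ⟨ha, fun a' ha' => hmax ha'⟩, ?_⟩
  rintro b ⟨hb, hbmax⟩
  by_contra hne
  obtain ⟨k, hk⟩ := Function.ne_iff.mp hne
  have hsum : ∑ n, (b n + a n) / 2 = (∑ n, b n + ∑ n, a n) / 2 := by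
    rw [← Finset.sum_add_distrib, Finset.sum_div]
  have hmid : (fun n => (b n + a n) / 2) ∈
      {a : Fin N → ℝ | (∀ n, 0 ≤ a n ∧ a n ≤ b₁) ∧ ∑ n, a n ≤ B₁} := by
    refine ⟨fun n => ?_, ?_⟩
    · have := hb.1 n
      have := ha.1 n
      constructor <;> linarith
    · have := hb.2
      have := ha.2
      simp only [hsum]
      linarith
  have hlt : ∑ n, ρ n * ((x₀ n + b n) / (1 + b n + a₂ n)) +
      ∑ n, ρ n * ((x₀ n + a n) / (1 + a n + a₂ n)) <
      2 * ∑ n, ρ n * ((x₀ n + (b n + a n) / 2) / (1 + (b n + a n) / 2 + a₂ n)) := by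
    rw [← Finset.sum_add_distrib, Finset.mul_sum]
    refine Finset.sum_lt_sum (fun n _ => ?_) ⟨k, Finset.mem_univ k, ?_⟩
    · have := mul_le_mul_of_nonneg_left (campaign_add_le_two_mul_midpoint (hx₀ n).2 (hb.1 n).1
        (ha.1 n).1 (ha₂ n)) (hρ n).le
      linarith
    · have := mul_lt_mul_of_pos_left (campaign_add_lt_two_mul_midpoint (hx₀ k).2 (hb.1 k).1
        (ha.1 k).1 (ha₂ k) hk) (hρ k)
      linarith
  have h₁ := hbmax _ hmid
  have h₂ := hbmax a ha
  have h₃ : u₁ (fun n => (b n + a n) / 2) a₂ ≤ u₁ a a₂ := hmax hmid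
  simp only [hu₁, hsum] at h₁ h₂ h₃
  have := mul_lt_mul_of_pos_left hlt hγ₁
  linarith
end

section
/- Define, for a₁, a₂ ∈ ℝ^N with nonnegative entries, the pseudo-gradient components g¹_n(a₁, a₂) := ρ_n (1 − x₀_n + a₂_n)/(1 + a₁_n + a₂_n)² − λ₁/γ₁ and g²_n(a₁, a₂) := ρ_n (x₀_n + a₁_n)/(1 + a₁_n + a₂_n)² − λ₂/γ₂ (these equal (1/γ₁)∂u₁/∂a₁_n and (1/γ₂)∂u₂/∂a₂_n, respectively). Then for every two distinct profiles (a₁, a₂) ≠ (a₁', a₂') with all entries nonnegative, ∑_{n=1}^N (a₁_n − a₁'_n)(g¹_n(a₁,a₂) − g¹_n(a₁',a₂')) + ∑_{n=1}^N (a₂_n − a₂'_n)(g²_n(a₁,a₂) − g²_n(a₁',a₂')) < 0. (Paper's Lemma 2: the weighted sum of utilities with weights r = (1/γ₁, 1/γ₂) satisfies Rosen's diagonally strict concavity condition.) -/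
/-- With `s = p + q`, `s' = p' + q'`, the monotonicity form of `(p, q) ↦ (q / s², p / s²)` is minus a
combination of the squares of `p * q' - p' * q` and `s - s'`. -/
theorem share_gradient_inner_eq {p q p' q' : ℝ} (hs : p + q ≠ 0) (hs' : p' + q' ≠ 0) :
    (p - p') * (q / (p + q) ^ 2 - q' / (p' + q') ^ 2) +
        (q - q') * (p / (p + q) ^ 2 - p' / (p' + q') ^ 2) =
      -(2 * (p * q' - p' * q) ^ 2 + (p * q' + p' * q) * ((p + q) - (p' + q')) ^ 2) /
        ((p + q) ^ 2 * (p' + q') ^ 2) := by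
  field_simp
  ring

theorem share_gradient_inner_nonpos {p q p' q' : ℝ} (hp : 0 < p) (hq : 0 < q)
    (hp' : 0 < p') (hq' : 0 < q') :
    (p - p') * (q / (p + q) ^ 2 - q' / (p' + q') ^ 2) +
      (q - q') * (p / (p + q) ^ 2 - p' / (p' + q') ^ 2) ≤ 0 := by
  rw [share_gradient_inner_eq (by positivity) (by positivity), neg_div]
  exact neg_nonpos.mpr (by positivity)

theorem share_gradient_inner_neg {p q p' q' : ℝ} (hp : 0 < p) (hq : 0 < q)
    (hp' : 0 < p') (hq' : 0 < q') (hne : ¬(p = p' ∧ q = q')) :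
    (p - p') * (q / (p + q) ^ 2 - q' / (p' + q') ^ 2) +
      (q - q') * (p / (p + q) ^ 2 - p' / (p' + q') ^ 2) < 0 := by
  rw [share_gradient_inner_eq (by positivity) (by positivity), neg_div]
  refine neg_neg_of_pos (div_pos ?_ (by positivity))
  by_cases hs : (p + q) - (p' + q') = 0
  · have hcross : p * q' - p' * q ≠ 0 := by
      intro h
      have hpp : (p - p') * (p + q) = 0 := by linear_combination h + p * hs
      have hpp : p - p' = 0 := (mul_eq_zero.mp hpp).resolve_right (by positivity)
      exact hne ⟨by linarith, by linarith⟩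
    positivity
  · positivity


/-- Paper's Lemma 2: the pseudo-gradient with weights (1/γ₁, 1/γ₂) satisfies
Rosen's diagonally strict concavity condition. -/
theorem stmt_3 (N : ℕ) (hN : 1 ≤ N)
    (ρ x₀ : Fin N → ℝ) (hρ : ∀ n, 0 < ρ n) (hx₀ : ∀ n, 0 < x₀ n ∧ x₀ n < 1)
    (γ₁ γ₂ lam₁ lam₂ : ℝ) (hγ₁ : 0 < γ₁) (hγ₂ : 0 < γ₂) (hlam₁ : 0 ≤ lam₁) (hlam₂ : 0 ≤ lam₂)
    (g₁ g₂ : (Fin N → ℝ) → (Fin N → ℝ) → Fin N → ℝ)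
    (hg₁ : ∀ a₁ a₂ n, g₁ a₁ a₂ n =
      ρ n * (1 - x₀ n + a₂ n) / (1 + a₁ n + a₂ n) ^ 2 - lam₁ / γ₁)
    (hg₂ : ∀ a₁ a₂ n, g₂ a₁ a₂ n =
      ρ n * (x₀ n + a₁ n) / (1 + a₁ n + a₂ n) ^ 2 - lam₂ / γ₂)
    (a₁ a₂ a₁' a₂' : Fin N → ℝ)
    (ha₁ : ∀ n, 0 ≤ a₁ n) (ha₂ : ∀ n, 0 ≤ a₂ n)
    (ha₁' : ∀ n, 0 ≤ a₁' n) (ha₂' : ∀ n, 0 ≤ a₂' n)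
    (hne : (a₁, a₂) ≠ (a₁', a₂')) :
    (∑ n, (a₁ n - a₁' n) * (g₁ a₁ a₂ n - g₁ a₁' a₂' n)) +
      (∑ n, (a₂ n - a₂' n) * (g₂ a₁ a₂ n - g₂ a₁' a₂' n)) < 0 := by
  have hterm : ∀ n, (a₁ n - a₁' n) * (g₁ a₁ a₂ n - g₁ a₁' a₂' n) +
      (a₂ n - a₂' n) * (g₂ a₁ a₂ n - g₂ a₁' a₂' n) =
      ρ n * (((x₀ n + a₁ n) - (x₀ n + a₁' n)) *
          ((1 - x₀ n + a₂ n) / ((x₀ n + a₁ n) + (1 - x₀ n + a₂ n)) ^ 2 -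
            (1 - x₀ n + a₂' n) / ((x₀ n + a₁' n) + (1 - x₀ n + a₂' n)) ^ 2) +
        ((1 - x₀ n + a₂ n) - (1 - x₀ n + a₂' n)) *
          ((x₀ n + a₁ n) / ((x₀ n + a₁ n) + (1 - x₀ n + a₂ n)) ^ 2 -
            (x₀ n + a₁' n) / ((x₀ n + a₁' n) + (1 - x₀ n + a₂' n)) ^ 2)) := by
    intro n
    have hs : (x₀ n + a₁ n) + (1 - x₀ n + a₂ n) = 1 + a₁ n + a₂ n := by ring
    have hs' : (x₀ n + a₁' n) + (1 - x₀ n + a₂' n) = 1 + a₁' n + a₂' n := by ring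
    rw [hg₁, hg₁, hg₂, hg₂, hs, hs']
    ring
  have hp : ∀ (a : Fin N → ℝ), (∀ n, 0 ≤ a n) → ∀ n, 0 < x₀ n + a n :=
    fun a ha n => add_pos_of_pos_of_nonneg (hx₀ n).1 (ha n)
  have hq : ∀ (a : Fin N → ℝ), (∀ n, 0 ≤ a n) → ∀ n, 0 < 1 - x₀ n + a n :=
    fun a ha n => add_pos_of_pos_of_nonneg (sub_pos.mpr (hx₀ n).2) (ha n)
  obtain ⟨m, hm⟩ : ∃ m, ¬(a₁ m = a₁' m ∧ a₂ m = a₂' m) := by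
    by_contra! h
    exact hne (Prod.ext (funext fun n => (h n).1) (funext fun n => (h n).2))
  rw [← Finset.sum_add_distrib, Finset.sum_congr rfl fun n _ => hterm n]
  refine Finset.sum_neg' (fun n _ => ?_) ⟨m, Finset.mem_univ m, ?_⟩
  · exact mul_nonpos_of_nonneg_of_nonpos (hρ n).le (share_gradient_inner_nonpos
      (hp a₁ ha₁ n) (hq a₂ ha₂ n) (hp a₁' ha₁' n) (hq a₂' ha₂' n))
  · exact mul_neg_of_pos_of_neg (hρ m) (share_gradient_inner_neg
      (hp a₁ ha₁ m) (hq a₂ ha₂ m) (hp a₁' ha₁' m) (hq a₂' ha₂' m)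
      (by simpa only [add_right_inj] using hm))
end

section
/- Let x ∈ (0,1) and ρ > 0, and define f₁(p, q) := ρ(1 − x + q)/(1 + p + q)² and f₂(p, q) := ρ(x + p)/(1 + p + q)² for p, q ≥ 0. Then for every two distinct pairs (p, q) ≠ (p', q') in [0,∞)², one has (p − p')(f₁(p,q) − f₁(p',q')) + (q − q')(f₂(p,q) − f₂(p',q')) < 0. (Single-agent version of the diagonally strict concavity property established in the paper's Lemma 2.) -/
/-- Single-agent diagonally strict concavity property (scalar version of the
paper's Lemma 2). -/
theorem stmt_4 (x ρ : ℝ) (hx : x ∈ Set.Ioo (0 : ℝ) 1) (hρ : 0 < ρ)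
    (f₁ f₂ : ℝ → ℝ → ℝ)
    (hf₁ : ∀ p q, f₁ p q = ρ * (1 - x + q) / (1 + p + q) ^ 2)
    (hf₂ : ∀ p q, f₂ p q = ρ * (x + p) / (1 + p + q) ^ 2)
    (p q p' q' : ℝ) (hp : 0 ≤ p) (hq : 0 ≤ q) (hp' : 0 ≤ p') (hq' : 0 ≤ q')
    (hne : (p, q) ≠ (p', q')) :
    (p - p') * (f₁ p q - f₁ p' q') + (q - q') * (f₂ p q - f₂ p' q') < 0 := by
  obtain ⟨hx0, hx1⟩ := hx
  have hs : 0 < 1 + p + q := by positivity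
  have ht : 0 < 1 + p' + q' := by positivity
  have ha : 0 < x + p := by linarith
  have hb : 0 < 1 - x + q := by linarith
  have ha' : 0 < x + p' := by linarith
  have hb' : 0 < 1 - x + q' := by linarith
  have key : (p - p') * (f₁ p q - f₁ p' q') + (q - q') * (f₂ p q - f₂ p' q') =
      -(ρ * (2 * ((x + p) * (1 - x + q') - (x + p') * (1 - x + q)) ^ 2 +
        ((x + p) * (1 - x + q') + (x + p') * (1 - x + q)) * ((p + q) - (p' + q')) ^ 2) /
        ((1 + p + q) ^ 2 * (1 + p' + q') ^ 2)) := by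
    simp only [hf₁, hf₂]
    field_simp
    ring
  rw [key, neg_lt_zero]
  refine div_pos (mul_pos hρ ?_) (by positivity)
  by_cases h : p + q = p' + q'
  · have hpp : p ≠ p' := by
      rintro rfl
      exact hne (by rw [add_left_cancel h])
    have hcross : (x + p) * (1 - x + q') - (x + p') * (1 - x + q) =
        (p - p') * (1 + p + q) := by
      linear_combination (-(x + p)) * h
    have : (p - p') * (1 + p + q) ≠ 0 := mul_ne_zero (sub_ne_zero.2 hpp) hs.ne'
    rw [hcross]
    positivity
  · have := sub_ne_zero.2 h
    positivity
end

section
/- For a₁, a₂ ∈ ℝ^N with nonnegative entries, define the 2N × 2N matrix G(a₁, a₂) with entries: G[n, n] = −2ρ_n(1 − x₀_n + a₂_n)/(1 + a₁_n + a₂_n)³, G[N+n, N+n] = −2ρ_n(x₀_n + a₁_n)/(1 + a₁_n + a₂_n)³, G[n, N+n] = ρ_n(−1 + 2x₀_n + a₁_n − a₂_n)/(1 + a₁_n + a₂_n)³, G[N+n, n] = ρ_n(1 − 2x₀_n − a₁_n + a₂_n)/(1 + a₁_n + a₂_n)³ for n = 1, …, N, and all other entries zero (G is the Jacobian of the pseudo-gradient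 of the weighted sum of utilities with weights (1/γ₁, 1/γ₂)). Then G(a₁, a₂) + G(a₁, a₂)ᵀ is negative definite: for every nonzero v ∈ ℝ^{2N}, vᵀ(G + Gᵀ)v < 0. -/
open Matrix

/-- The Jacobian G of the pseudo-gradient of the weighted sum of utilities
satisfies: G + Gᵀ is negative definite. Indices are split as Fin N ⊕ Fin N,
the left block corresponding to Firm 1's variables and the right block to
Firm 2's variables. -/
theorem stmt_5 (N : ℕ) (hN : 1 ≤ N)
    (ρ x₀ : Fin N → ℝ) (hρ : ∀ n, 0 < ρ n) (hx₀ : ∀ n, 0 < x₀ n ∧ x₀ n < 1)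
    (a₁ a₂ : Fin N → ℝ) (ha₁ : ∀ n, 0 ≤ a₁ n) (ha₂ : ∀ n, 0 ≤ a₂ n)
    (G : Matrix (Fin N ⊕ Fin N) (Fin N ⊕ Fin N) ℝ)
    (hG : G = Matrix.of fun i j =>
      match i, j with
      | Sum.inl n, Sum.inl m =>
          if n = m then -2 * ρ n * (1 - x₀ n + a₂ n) / (1 + a₁ n + a₂ n) ^ 3 else 0
      | Sum.inl n, Sum.inr m =>
          if n = m then ρ n * (-1 + 2 * x₀ n + a₁ n - a₂ n) / (1 + a₁ n + a₂ n) ^ 3 else 0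
      | Sum.inr n, Sum.inl m =>
          if n = m then ρ n * (1 - 2 * x₀ n - a₁ n + a₂ n) / (1 + a₁ n + a₂ n) ^ 3 else 0
      | Sum.inr n, Sum.inr m =>
          if n = m then -2 * ρ n * (x₀ n + a₁ n) / (1 + a₁ n + a₂ n) ^ 3 else 0)
    (v : Fin N ⊕ Fin N → ℝ) (hv : v ≠ 0) :
    v ⬝ᵥ (G + Gᵀ) *ᵥ v < 0 := by
  have hpos : ∀ n, 0 < 4 * ρ n * (1 - x₀ n + a₂ n) / (1 + a₁ n + a₂ n) ^ 3 ∧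
      0 < 4 * ρ n * (x₀ n + a₁ n) / (1 + a₁ n + a₂ n) ^ 3 := by
    intro n
    have h₁ := hρ n
    have h₂ := ha₁ n
    have h₃ := ha₂ n
    obtain ⟨h₄, h₅⟩ := hx₀ n
    have h₆ : 0 < 1 - x₀ n + a₂ n := by linarith
    constructor <;> positivity
  have hquad : v ⬝ᵥ (G + Gᵀ) *ᵥ v =
      -((∑ n, 4 * ρ n * (1 - x₀ n + a₂ n) / (1 + a₁ n + a₂ n) ^ 3 * v (Sum.inl n) ^ 2) +
        ∑ n, 4 * ρ n * (x₀ n + a₁ n) / (1 + a₁ n + a₂ n) ^ 3 * v (Sum.inr n) ^ 2) := by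
    have hdiag : G + Gᵀ = Matrix.diagonal (Sum.elim
        (fun n => -(4 * ρ n * (1 - x₀ n + a₂ n) / (1 + a₁ n + a₂ n) ^ 3))
        (fun n => -(4 * ρ n * (x₀ n + a₁ n) / (1 + a₁ n + a₂ n) ^ 3))) := by
      subst hG
      ext i j
      rcases i with n | n <;> rcases j with m | m <;> by_cases h : n = m <;>
        first
        | (subst h; simp; ring)
        | simp [h, Ne.symm h]
    simp only [hdiag, dotProduct, Matrix.mulVec_diagonal, Fintype.sum_sum_type, Sum.elim_inl,
      Sum.elim_inr, neg_add, ← Finset.sum_neg_distrib]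
    congr 1 <;> exact Finset.sum_congr rfl fun n _ => by ring
  rw [hquad, neg_lt_zero]
  have hl : ∀ n ∈ Finset.univ,
      0 ≤ 4 * ρ n * (1 - x₀ n + a₂ n) / (1 + a₁ n + a₂ n) ^ 3 * v (Sum.inl n) ^ 2 :=
    fun n _ => mul_nonneg (hpos n).1.le (sq_nonneg _)
  have hr : ∀ n ∈ Finset.univ,
      0 ≤ 4 * ρ n * (x₀ n + a₁ n) / (1 + a₁ n + a₂ n) ^ 3 * v (Sum.inr n) ^ 2 :=
    fun n _ => mul_nonneg (hpos n).2.le (sq_nonneg _)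
  obtain ⟨i, hi⟩ := Function.ne_iff.mp hv
  rw [Pi.zero_apply] at hi
  rcases i with n | n
  · exact add_pos_of_pos_of_nonneg
      (Finset.sum_pos' hl ⟨n, Finset.mem_univ n, mul_pos (hpos n).1 (by positivity)⟩)
      (Finset.sum_nonneg hr)
  · exact add_pos_of_nonneg_of_pos (Finset.sum_nonneg hl)
      (Finset.sum_pos' hr ⟨n, Finset.mem_univ n, mul_pos (hpos n).2 (by positivity)⟩)
end

section
/- There exists a pure Nash equilibrium of the duopoly marketing game: there is a pair (a₁*, a₂*) ∈ A₁ × A₂ such that u₁(a₁*, a₂*) ≥ u₁(a₁, a₂*) for all a₁ ∈ A₁ and u₂(a₁*, a₂*) ≥ u₂(a₁*, a₂) for all a₂ ∈ A₂. (Existence part of the paper's Theorem 1.) -/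
theorem convexOn_div_const_add {k d : ℝ} (hk : 0 ≤ k) (hd : 0 < d) :
    ConvexOn ℝ (Set.Ici 0) fun s : ℝ => k / (d + s) := by
  refine ⟨convex_Ici 0, fun x hx y hy α β hα hβ hαβ => ?_⟩
  simp only [Set.mem_Ici, smul_eq_mul] at *
  have hx' : 0 < d + x := by linarith
  have hy' : 0 < d + y := by linarith
  have hz : 0 < d + (α * x + β * y) := by positivity
  obtain rfl : β = 1 - α := by linarith
  have key : α * (k / (d + x)) + (1 - α) * (k / (d + y)) - k / (d + (α * x + (1 - α) * y)) =
      k * (α * (1 - α) * (x - y) ^ 2) /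
        ((d + x) * (d + y) * (d + (α * x + (1 - α) * y))) := by
    field_simp
    ring
  have : 0 ≤ k * (α * (1 - α) * (x - y) ^ 2) /
      ((d + x) * (d + y) * (d + (α * x + (1 - α) * y))) := by positivity
  linarith

theorem convexOn_sum_div_add_linear {ι : Type*} [Fintype ι] {k d : ι → ℝ}
    (hk : ∀ n, 0 ≤ k n) (hd : ∀ n, 0 < d n) (c m : ℝ) {A : Set (ι → ℝ)} (hA : Convex ℝ A)
    (hA₀ : ∀ a ∈ A, ∀ n, 0 ≤ a n) :
    ConvexOn ℝ A fun a : ι → ℝ => ∑ n, k n / (d n + a n) + c * ∑ n, a n + m := by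
  refine ⟨hA, fun x hx y hy α β hα hβ hαβ => ?_⟩
  have h := Finset.sum_le_sum fun n (_ : n ∈ Finset.univ) =>
    (convexOn_div_const_add (hk n) (hd n)).2 (hA₀ x hx n) (hA₀ y hy n) hα hβ hαβ
  simp only [smul_eq_mul, Finset.sum_add_distrib, ← Finset.mul_sum, Pi.add_apply,
    Pi.smul_apply] at h ⊢
  obtain rfl : β = 1 - α := by linarith
  linarith

theorem continuousOn_sum_div_add_linear {ι : Type*} [Fintype ι] {k d : ι → ℝ}
    (hd : ∀ n, 0 < d n) (c m : ℝ) {A : Set (ι → ℝ)} (hA₀ : ∀ a ∈ A, ∀ n, 0 ≤ a n) :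
    ContinuousOn (fun a : ι → ℝ => ∑ n, k n / (d n + a n) + c * ∑ n, a n + m) A := by
  have h : ∀ n, ContinuousOn (fun a : ι → ℝ => k n / (d n + a n)) A := fun n =>
    ContinuousOn.div (by fun_prop) (by fun_prop) fun a ha =>
      (add_pos_of_pos_of_nonneg (hd n) (hA₀ a ha n)).ne'
  fun_prop

theorem convex_actionSet {ι : Type*} [Fintype ι] (b B : ℝ) :
    Convex ℝ {a : ι → ℝ | (∀ n, 0 ≤ a n ∧ a n ≤ b) ∧ ∑ n, a n ≤ B} := by
  rintro x ⟨hx, hxB⟩ y ⟨hy, hyB⟩ α β hα hβ hαβ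
  refine ⟨fun n => convex_Icc (0 : ℝ) b (hx n) (hy n) hα hβ hαβ, ?_⟩
  have h := convex_Iic B hxB hyB hα hβ hαβ
  simpa [Finset.sum_add_distrib, Finset.mul_sum] using h

theorem isCompact_actionSet {ι : Type*} [Fintype ι] (b B : ℝ) :
    IsCompact {a : ι → ℝ | (∀ n, 0 ≤ a n ∧ a n ≤ b) ∧ ∑ n, a n ≤ B} := by
  have h : IsCompact (Set.univ.pi fun _ : ι => Set.Icc (0 : ℝ) b) :=
    isCompact_univ_pi fun _ => isCompact_Icc
  have hB : IsClosed {a : ι → ℝ | ∑ n, a n ≤ B} := isClosed_le (by fun_prop) continuous_const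
  convert h.inter_right hB using 1
  ext a
  simp only [Set.mem_inter_iff, Set.mem_univ_pi, Set.mem_Icc, Set.mem_ofPred_eq]

/-- Up to positive scaling and terms in the opponent's action alone, the game is zero-sum with this
convex-concave payoff, so that Sion's theorem applies. -/
theorem exists_isSaddlePointOn_campaign {ι : Type*} [Fintype ι] {ρ x₀ : ι → ℝ}
    (hρ : ∀ n, 0 < ρ n) (hx₀ : ∀ n, 0 < x₀ n ∧ x₀ n < 1) (c₁ c₂ : ℝ)
    {A₁ A₂ : Set (ι → ℝ)} (h₁ : Convex ℝ A₁) (h₂ : Convex ℝ A₂)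
    (hc₁ : IsCompact A₁) (hc₂ : IsCompact A₂) (hn₁ : A₁.Nonempty) (hn₂ : A₂.Nonempty)
    (hp₁ : ∀ a ∈ A₁, ∀ n, 0 ≤ a n) (hp₂ : ∀ a ∈ A₂, ∀ n, 0 ≤ a n) :
    ∃ a₂ ∈ A₂, ∃ a₁ ∈ A₁, IsSaddlePointOn A₂ A₁ (fun a₂ a₁ : ι → ℝ =>
      ∑ n, ρ n * ((x₀ n + a₁ n) / (1 + a₁ n + a₂ n)) - c₁ * ∑ n, a₁ n + c₂ * ∑ n, a₂ n)
      a₂ a₁ := by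
  have e₂ : ∀ a₁ : ι → ℝ, (fun a₂ : ι → ℝ =>
      ∑ n, ρ n * ((x₀ n + a₁ n) / (1 + a₁ n + a₂ n)) - c₁ * ∑ n, a₁ n + c₂ * ∑ n, a₂ n) =
      fun a₂ => ∑ n, (ρ n * (x₀ n + a₁ n)) / ((1 + a₁ n) + a₂ n) + c₂ * ∑ n, a₂ n +
        -(c₁ * ∑ n, a₁ n) := by
    intro a₁
    funext a₂
    simp only [mul_div_assoc]
    ring
  have e₁ : ∀ a₂ ∈ A₂, Set.EqOn (fun a₁ : ι → ℝ =>
      ∑ n, ρ n * ((x₀ n + a₁ n) / (1 + a₁ n + a₂ n)) - c₁ * ∑ n, a₁ n + c₂ * ∑ n, a₂ n)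
      (-fun a₁ => ∑ n, (ρ n * (1 + a₂ n - x₀ n)) / ((1 + a₂ n) + a₁ n) + c₁ * ∑ n, a₁ n +
        -(∑ n, ρ n + c₂ * ∑ n, a₂ n)) A₁ := by
    intro a₂ ha₂ a₁ ha₁
    have h : ∀ n, ρ n * ((x₀ n + a₁ n) / (1 + a₁ n + a₂ n)) =
        ρ n - (ρ n * (1 + a₂ n - x₀ n)) / ((1 + a₂ n) + a₁ n) := by
      intro n
      have := hp₁ a₁ ha₁ n
      have := hp₂ a₂ ha₂ n
      have h' : 1 + a₁ n + a₂ n ≠ 0 := by positivity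
      rw [add_right_comm 1 (a₂ n) (a₁ n)]
      field_simp
      ring
    simp only [h, Finset.sum_sub_distrib, Pi.neg_apply]
    ring
  have d₁ : ∀ a ∈ A₁, ∀ n, 0 < 1 + a n := fun a ha n => by linarith [hp₁ a ha n]
  have d₂ : ∀ a ∈ A₂, ∀ n, 0 < 1 + a n := fun a ha n => by linarith [hp₂ a ha n]
  refine Sion.exists_isSaddlePointOn' (ne_X := hn₂) (kX := hc₂) (cX := h₂) (cY := h₁)
    (ne_Y := hn₁) (kY := hc₁) (hfy := ?_) (hfy' := ?_) (hfx := ?_) (hfx' := ?_)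
  · intro a₁ ha₁
    rw [e₂ a₁]
    exact (continuousOn_sum_div_add_linear (d₁ a₁ ha₁) _ _ hp₂).lowerSemicontinuousOn
  · intro a₁ ha₁
    rw [e₂ a₁]
    refine (convexOn_sum_div_add_linear (fun n => ?_) (d₁ a₁ ha₁) _ _ h₂ hp₂).quasiconvexOn
    exact mul_nonneg (hρ n).le (by linarith [(hx₀ n).1, hp₁ a₁ ha₁ n])
  · intro a₂ ha₂
    exact ((continuousOn_sum_div_add_linear (d₂ a₂ ha₂) _ _ hp₁).neg.congr
      (e₁ a₂ ha₂)).upperSemicontinuousOn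
  · intro a₂ ha₂
    refine ((convexOn_sum_div_add_linear (fun n => ?_) (d₂ a₂ ha₂) _ _ h₁ hp₁).neg.congr
      (e₁ a₂ ha₂).symm).quasiconcaveOn
    exact mul_nonneg (hρ n).le (by linarith [(hx₀ n).2, hp₂ a₂ ha₂ n])

/-- Existence of a pure Nash equilibrium of the duopoly marketing game
(existence part of the paper's Theorem 1). -/
theorem stmt_6 (N : ℕ) (hN : 1 ≤ N)
    (ρ x₀ : Fin N → ℝ) (hρ : ∀ n, 0 < ρ n) (hx₀ : ∀ n, 0 < x₀ n ∧ x₀ n < 1)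
    (γ₁ γ₂ lam₁ lam₂ : ℝ) (hγ₁ : 0 < γ₁) (hγ₂ : 0 < γ₂) (hlam₁ : 0 ≤ lam₁) (hlam₂ : 0 ≤ lam₂)
    (b₁ B₁ b₂ B₂ : ℝ) (hb₁ : 0 ≤ b₁) (hB₁ : b₁ ≤ B₁) (hb₂ : 0 ≤ b₂) (hB₂ : b₂ ≤ B₂)
    (A₁ A₂ : Set (Fin N → ℝ))
    (hA₁ : A₁ = {a : Fin N → ℝ | (∀ n, 0 ≤ a n ∧ a n ≤ b₁) ∧ ∑ n, a n ≤ B₁})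
    (hA₂ : A₂ = {a : Fin N → ℝ | (∀ n, 0 ≤ a n ∧ a n ≤ b₂) ∧ ∑ n, a n ≤ B₂})
    (φ : ℝ → ℝ → ℝ → ℝ) (hφ : ∀ x a a', φ x a a' = (x + a) / (1 + a + a'))
    (u₁ u₂ : (Fin N → ℝ) → (Fin N → ℝ) → ℝ)
    (hu₁ : ∀ a₁ a₂, u₁ a₁ a₂ =
      γ₁ * ∑ n, ρ n * φ (x₀ n) (a₁ n) (a₂ n) - lam₁ * ∑ n, a₁ n)
    (hu₂ : ∀ a₁ a₂, u₂ a₁ a₂ =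
      γ₂ * ∑ n, ρ n * (1 - φ (x₀ n) (a₁ n) (a₂ n)) - lam₂ * ∑ n, a₂ n) :
    ∃ a₁star ∈ A₁, ∃ a₂star ∈ A₂,
      (∀ a₁ ∈ A₁, u₁ a₁ a₂star ≤ u₁ a₁star a₂star) ∧
      (∀ a₂ ∈ A₂, u₂ a₁star a₂ ≤ u₂ a₁star a₂star) := by
  have z₁ : A₁.Nonempty := ⟨0, by simpa [hA₁] using ⟨fun _ => hb₁, hb₁.trans hB₁⟩⟩
  have z₂ : A₂.Nonempty := ⟨0, by simpa [hA₂] using ⟨fun _ => hb₂, hb₂.trans hB₂⟩⟩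
  obtain ⟨s₂, hs₂, s₁, hs₁, hs⟩ := exists_isSaddlePointOn_campaign hρ hx₀
    (lam₁ / γ₁) (lam₂ / γ₂) (hA₁ ▸ convex_actionSet b₁ B₁) (hA₂ ▸ convex_actionSet b₂ B₂)
    (hA₁ ▸ isCompact_actionSet b₁ B₁) (hA₂ ▸ isCompact_actionSet b₂ B₂) z₁ z₂
    (fun a ha n => by rw [hA₁] at ha; exact (ha.1 n).1)
    (fun a ha n => by rw [hA₂] at ha; exact (ha.1 n).1)
  refine ⟨s₁, hs₁, s₂, hs₂, fun a ha => ?_, fun a ha => ?_⟩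
  · have h := mul_le_mul_of_nonneg_left (hs s₂ hs₂ a ha) hγ₁.le
    simp only [mul_add, mul_sub, ← mul_assoc, mul_div_cancel₀ lam₁ hγ₁.ne'] at h
    simp only [hu₁, hφ]
    linarith
  · have h := mul_le_mul_of_nonneg_left (hs a ha s₁ hs₁) hγ₂.le
    simp only [mul_add, mul_sub, ← mul_assoc, mul_div_cancel₀ lam₂ hγ₂.ne'] at h
    simp only [hu₂, hφ, mul_sub, Finset.sum_sub_distrib]
    linarith
end

section
/- The pure Nash equilibrium of the duopoly marketing game is unique: if (a₁*, a₂*) ∈ A₁ × A₂ and (â₁, â₂) ∈ A₁ × A₂ are both pure Nash equilibria, then a₁* = â₁ and a₂* = â₂. (Uniqueness part of the paper's Theorem 1, proved via Rosen's diagonally strict concavity condition.) -/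
/-- The share `(x + a) / (1 + a + d)` is strictly midpoint concave in `a`. -/
theorem share_midpoint_lt {x d p q : ℝ} (hx : x < 1) (hd : 0 ≤ d) (hp : 0 ≤ p) (hq : 0 ≤ q)
    (hpq : p ≠ q) :
    ((x + p) / (1 + p + d) + (x + q) / (1 + q + d)) / 2 <
      (x + (p + q) / 2) / (1 + (p + q) / 2 + d) := by
  have h : (x + (p + q) / 2) / (1 + (p + q) / 2 + d) -
      ((x + p) / (1 + p + d) + (x + q) / (1 + q + d)) / 2 =
      (1 - x + d) * (p - q) ^ 2 /
        (4 * (1 + p + d) * (1 + q + d) * (1 + (p + q) / 2 + d)) := by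
    have h₁ : 1 + p + d ≠ 0 := by positivity
    have h₂ : 1 + q + d ≠ 0 := by positivity
    have h₃ : 1 + (p + q) / 2 + d ≠ 0 := by positivity
    have h₄ : 2 + (p + q) + 2 * d ≠ 0 := by positivity
    field_simp
    ring
  have hsq : 0 < (p - q) ^ 2 := by have := sub_ne_zero.mpr hpq; positivity
  have hc : 0 < 1 - x + d := by linarith
  have : 0 < (1 - x + d) * (p - q) ^ 2 /
      (4 * (1 + p + d) * (1 + q + d) * (1 + (p + q) / 2 + d)) := by positivity
  linarith

/-- Two campaigns with equal payoff against `d` coincide if their midpoint is no better. -/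
theorem eq_of_midpoint_payoff_le {ι : Type*} [Fintype ι] {ρ x p q d : ι → ℝ} {γ l : ℝ}
    (hγ : 0 < γ) (hρ : ∀ n, 0 < ρ n) (hx : ∀ n, x n < 1) (hd : ∀ n, 0 ≤ d n)
    (hp : ∀ n, 0 ≤ p n) (hq : ∀ n, 0 ≤ q n)
    (heq : γ * ∑ n, ρ n * ((x n + q n) / (1 + q n + d n)) - l * ∑ n, q n =
      γ * ∑ n, ρ n * ((x n + p n) / (1 + p n + d n)) - l * ∑ n, p n)
    (hle : γ * ∑ n, ρ n * ((x n + (p n + q n) / 2) / (1 + (p n + q n) / 2 + d n)) -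
        l * ∑ n, (p n + q n) / 2 ≤
      γ * ∑ n, ρ n * ((x n + p n) / (1 + p n + d n)) - l * ∑ n, p n) :
    p = q := by
  by_contra hne
  obtain ⟨m, hm⟩ := Function.ne_iff.mp hne
  have hlt : ∑ n, ρ n * (((x n + p n) / (1 + p n + d n) + (x n + q n) / (1 + q n + d n)) / 2) <
      ∑ n, ρ n * ((x n + (p n + q n) / 2) / (1 + (p n + q n) / 2 + d n)) := by
    refine Finset.sum_lt_sum (fun n _ => ?_) ⟨m, Finset.mem_univ m, ?_⟩
    · by_cases h : p n = q n
      · simp [h]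
      · exact (mul_lt_mul_of_pos_left
          (share_midpoint_lt (hx n) (hd n) (hp n) (hq n) h) (hρ n)).le
    · exact mul_lt_mul_of_pos_left (share_midpoint_lt (hx m) (hd m) (hp m) (hq m) hm) (hρ m)
  have hsum : ∑ n, ρ n * (((x n + p n) / (1 + p n + d n) + (x n + q n) / (1 + q n + d n)) / 2) =
      (∑ n, ρ n * ((x n + p n) / (1 + p n + d n)) +
        ∑ n, ρ n * ((x n + q n) / (1 + q n + d n))) / 2 := by
    rw [← Finset.sum_add_distrib, Finset.sum_div]
    exact Finset.sum_congr rfl fun n _ => by ring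
  have hmid : ∑ n, (p n + q n) / 2 = (∑ n, p n + ∑ n, q n) / 2 := by
    rw [← Finset.sum_div, Finset.sum_add_distrib]
  rw [hsum] at hlt
  rw [hmid] at hle
  have := mul_lt_mul_of_pos_left hlt hγ
  linarith

/-- A budget set is closed under midpoints. -/
theorem midpoint_mem_budget {ι : Type*} [Fintype ι] {p q : ι → ℝ} {b B : ℝ}
    (hp : p ∈ {a : ι → ℝ | (∀ n, 0 ≤ a n ∧ a n ≤ b) ∧ ∑ n, a n ≤ B})
    (hq : q ∈ {a : ι → ℝ | (∀ n, 0 ≤ a n ∧ a n ≤ b) ∧ ∑ n, a n ≤ B}) :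
    (fun n => (p n + q n) / 2) ∈ {a : ι → ℝ | (∀ n, 0 ≤ a n ∧ a n ≤ b) ∧ ∑ n, a n ≤ B} := by
  obtain ⟨hp, hpB⟩ := hp
  obtain ⟨hq, hqB⟩ := hq
  refine ⟨fun n => ?_, ?_⟩
  · obtain ⟨h₁, h₂⟩ := hp n
    obtain ⟨h₃, h₄⟩ := hq n
    constructor <;> dsimp only <;> linarith
  · rw [← Finset.sum_div, Finset.sum_add_distrib]
    linarith


/-- Uniqueness of the pure Nash equilibrium of the duopoly marketing game
(uniqueness part of the paper's Theorem 1). -/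
theorem stmt_7 (N : ℕ) (hN : 1 ≤ N)
    (ρ x₀ : Fin N → ℝ) (hρ : ∀ n, 0 < ρ n) (hx₀ : ∀ n, 0 < x₀ n ∧ x₀ n < 1)
    (γ₁ γ₂ lam₁ lam₂ : ℝ) (hγ₁ : 0 < γ₁) (hγ₂ : 0 < γ₂) (hlam₁ : 0 ≤ lam₁) (hlam₂ : 0 ≤ lam₂)
    (b₁ B₁ b₂ B₂ : ℝ) (hb₁ : 0 ≤ b₁) (hB₁ : b₁ ≤ B₁) (hb₂ : 0 ≤ b₂) (hB₂ : b₂ ≤ B₂)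
    (A₁ A₂ : Set (Fin N → ℝ))
    (hA₁ : A₁ = {a : Fin N → ℝ | (∀ n, 0 ≤ a n ∧ a n ≤ b₁) ∧ ∑ n, a n ≤ B₁})
    (hA₂ : A₂ = {a : Fin N → ℝ | (∀ n, 0 ≤ a n ∧ a n ≤ b₂) ∧ ∑ n, a n ≤ B₂})
    (φ : ℝ → ℝ → ℝ → ℝ) (hφ : ∀ x a a', φ x a a' = (x + a) / (1 + a + a'))
    (u₁ u₂ : (Fin N → ℝ) → (Fin N → ℝ) → ℝ)
    (hu₁ : ∀ a₁ a₂, u₁ a₁ a₂ =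
      γ₁ * ∑ n, ρ n * φ (x₀ n) (a₁ n) (a₂ n) - lam₁ * ∑ n, a₁ n)
    (hu₂ : ∀ a₁ a₂, u₂ a₁ a₂ =
      γ₂ * ∑ n, ρ n * (1 - φ (x₀ n) (a₁ n) (a₂ n)) - lam₂ * ∑ n, a₂ n)
    (a₁star a₂star a₁hat a₂hat : Fin N → ℝ)
    (hstar₁ : a₁star ∈ A₁) (hstar₂ : a₂star ∈ A₂) (hhat₁ : a₁hat ∈ A₁) (hhat₂ : a₂hat ∈ A₂)
    (hNEstar₁ : ∀ a₁ ∈ A₁, u₁ a₁ a₂star ≤ u₁ a₁star a₂star)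
    (hNEstar₂ : ∀ a₂ ∈ A₂, u₂ a₁star a₂ ≤ u₂ a₁star a₂star)
    (hNEhat₁ : ∀ a₁ ∈ A₁, u₁ a₁ a₂hat ≤ u₁ a₁hat a₂hat)
    (hNEhat₂ : ∀ a₂ ∈ A₂, u₂ a₁hat a₂ ≤ u₂ a₁hat a₂hat) :
    a₁star = a₁hat ∧ a₂star = a₂hat := by
  subst hA₁ hA₂
  have hsum : ∀ a₁ a₂, γ₂ * u₁ a₁ a₂ + γ₁ * u₂ a₁ a₂ =
      γ₁ * γ₂ * ∑ n, ρ n - γ₂ * lam₁ * ∑ n, a₁ n - γ₁ * lam₂ * ∑ n, a₂ n := by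
    intro a₁ a₂
    simp only [hu₁, hu₂, mul_sub, mul_one, Finset.sum_sub_distrib]
    ring
  have h₁ := mul_le_mul_of_nonneg_left (hNEstar₁ _ hhat₁) hγ₂.le
  have h₂ := mul_le_mul_of_nonneg_left (hNEstar₂ _ hhat₂) hγ₁.le
  have h₃ := mul_le_mul_of_nonneg_left (hNEhat₁ _ hstar₁) hγ₂.le
  have h₄ := mul_le_mul_of_nonneg_left (hNEhat₂ _ hstar₂) hγ₁.le
  have hss := hsum a₁star a₂star
  have hsh := hsum a₁star a₂hat
  have hhs := hsum a₁hat a₂star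
  have hhh := hsum a₁hat a₂hat
  have e₁ : u₁ a₁hat a₂star = u₁ a₁star a₂star :=
    mul_left_cancel₀ hγ₂.ne' (by linarith)
  have e₂ : u₂ a₁star a₂hat = u₂ a₁star a₂star :=
    mul_left_cancel₀ hγ₁.ne' (by linarith)
  have m₁ := hNEstar₁ _ (midpoint_mem_budget hstar₁ hhat₁)
  have m₂ := hNEstar₂ _ (midpoint_mem_budget hstar₂ hhat₂)
  have hpos₁ : ∀ n, 0 ≤ a₁star n := fun n => (hstar₁.1 n).1
  have hpos₂ : ∀ n, 0 ≤ a₂star n := fun n => (hstar₂.1 n).1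
  have hu₂' : ∀ a₂ : Fin N → ℝ, (∀ n, 0 ≤ a₂ n) → u₂ a₁star a₂ =
      γ₂ * ∑ n, ρ n * ((1 - x₀ n + a₂ n) / (1 + a₂ n + a₁star n)) - lam₂ * ∑ n, a₂ n := by
    intro a₂ ha₂
    rw [hu₂]
    congr 2
    refine Finset.sum_congr rfl fun n _ => ?_
    have h₁ := hpos₁ n
    have h₂ := ha₂ n
    have h₃ : 1 + a₁star n + a₂ n ≠ 0 := by positivity
    rw [hφ, show 1 + a₂ n + a₁star n = 1 + a₁star n + a₂ n by ring, one_sub_div h₃]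
    ring
  constructor
  · simp only [hu₁, hφ] at e₁ m₁
    exact eq_of_midpoint_payoff_le hγ₁ hρ (fun n => (hx₀ n).2) hpos₂ hpos₁
      (fun n => (hhat₁.1 n).1) e₁ m₁
  · rw [hu₂' _ hpos₂, hu₂' _ fun n => (hhat₂.1 n).1] at e₂
    rw [hu₂' _ hpos₂, hu₂' _ fun n => ((midpoint_mem_budget hstar₂ hhat₂).1 n).1] at m₂
    exact eq_of_midpoint_payoff_le hγ₂ hρ (fun n => sub_lt_self 1 (hx₀ n).1) hpos₁ hpos₂
      (fun n => (hhat₂.1 n).1) e₂ m₂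
end

section
/- Assume λ₁ > 0 and fix a₂ ∈ ℝ^N with a₂_n ≥ 0 for all n. Then there exists μ₀ ≥ 0 such that the vector β ∈ ℝ^N defined by β_n := min{ b₁, max{ 0, √(γ₁ ρ_n (1 − x₀_n + a₂_n)/(μ₀ + λ₁)) − 1 − a₂_n } } satisfies ∑_{n=1}^N β_n ≤ B₁ and μ₀ · (∑_{n=1}^N β_n − B₁) = 0. Moreover, for every μ₀ ≥ 0 with these two properties, the corresponding β belongs to A₁ and is a maximizer of a₁ ↦ u₁(a₁, a₂) over A₁. (Paper's Proposition 1, the water-filling best-response formula, stated for Firm 1; the statement for Firm 2 is symmetric with x₀_n replaced by 1 − x₀_n.) -/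
/-- On `[d, d + b]`, the function `t ↦ s ^ 2 / t + t` is minimal at the point nearest to `s`. -/
theorem sq_div_add_self_clamp_le {d b s a : ℝ} (hd : 0 < d) (hs : 0 ≤ s) (ha : 0 ≤ a)
    (hab : a ≤ b) :
    s ^ 2 / (d + min b (max 0 (s - d))) + (d + min b (max 0 (s - d))) ≤
      s ^ 2 / (d + a) + (d + a) := by
  have hb : 0 ≤ b := ha.trans hab
  set t := d + min b (max 0 (s - d)) with ht
  have ht0 : 0 < t := add_pos_of_pos_of_nonneg hd (le_min hb (le_max_left _ _))
  have ha0 : 0 < d + a := by linarith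
  have key : 0 ≤ (d + a - t) * ((d + a) * t - s ^ 2) := by
    rcases le_total s d with h | h
    · have : t = d := by
        rw [ht, max_eq_left (by linarith), min_eq_right hb, add_zero]
      rw [this]
      refine mul_nonneg (by linarith) ?_
      nlinarith
    · rw [max_eq_right (by linarith)] at ht
      rcases le_total b (s - d) with h' | h'
      · rw [min_eq_left h'] at ht
        refine mul_nonneg_of_nonpos_of_nonpos (by linarith) ?_
        nlinarith
      · rw [min_eq_right h'] at ht
        have hts : t = s := by linarith
        rw [hts]
        calc (0 : ℝ) ≤ s * (d + a - s) ^ 2 := by positivity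
          _ = _ := by ring
  have hdiff : s ^ 2 / (d + a) + (d + a) - (s ^ 2 / t + t) =
      (d + a - t) * ((d + a) * t - s ^ 2) / ((d + a) * t) := by
    field_simp
    ring
  have := div_nonneg key (mul_pos ha0 ht0).le
  linarith

/-- The clamped square-root allocation maximizes the penalized utility of a single agent. -/
theorem agent_utility_le_clamp {k x e m b a : ℝ} (hk : 0 ≤ k) (hx : x ≤ 1) (he : 0 ≤ e)
    (hm : 0 < m) (ha : 0 ≤ a) (hab : a ≤ b) :
    k * ((x + a) / (1 + a + e)) - m * a ≤
      k * ((x + min b (max 0 (√(k * (1 - x + e) / m) - 1 - e))) /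
        (1 + min b (max 0 (√(k * (1 - x + e) / m) - 1 - e)) + e)) -
        m * min b (max 0 (√(k * (1 - x + e) / m) - 1 - e)) := by
  have hc : 0 ≤ k * (1 - x + e) / m := div_nonneg (mul_nonneg hk (by linarith)) hm.le
  have h := sq_div_add_self_clamp_le (d := 1 + e) (by linarith)
    (Real.sqrt_nonneg (k * (1 - x + e) / m)) ha hab
  rw [Real.sq_sqrt hc, ← sub_sub] at h
  have hv : 0 ≤ min b (max 0 (√(k * (1 - x + e) / m) - 1 - e)) :=
    le_min (ha.trans hab) (le_max_left _ _)
  generalize min b (max 0 (√(k * (1 - x + e) / m) - 1 - e)) = v at h hv ⊢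
  have hutil : ∀ w, 0 ≤ w → k * ((x + w) / (1 + w + e)) - m * w =
      k + m * (1 + e) - m * (k * (1 - x + e) / m / (1 + e + w) + (1 + e + w)) := by
    intro w hw
    have h1 : 1 + w + e ≠ 0 := by positivity
    rw [show 1 + e + w = 1 + w + e by ring]
    field_simp
    ring
  rw [hutil a ha, hutil v hv]
  have := mul_le_mul_of_nonneg_left h hm.le
  linarith

/-- A continuous function on `[0, M]` with `f M ≤ B` admits a complementary-slackness level. -/
theorem exists_complementary_slackness {f : ℝ → ℝ} {M B : ℝ} (hM : 0 ≤ M)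
    (hf : ContinuousOn f (Set.Icc 0 M)) (hfM : f M ≤ B) :
    ∃ μ, 0 ≤ μ ∧ f μ ≤ B ∧ μ * (f μ - B) = 0 := by
  rcases le_total (f 0) B with h | h
  · exact ⟨0, le_rfl, h, zero_mul _⟩
  · obtain ⟨μ, hμ, hfμ⟩ := intermediate_value_Icc' hM hf ⟨hfM, h⟩
    exact ⟨μ, hμ.1, hfμ.le, by rw [hfμ, sub_self, mul_zero]⟩

/-- Paper's Proposition 1 (water-filling best response of Firm 1): some
water level μ₀ ≥ 0 satisfies the complementary-slackness conditions, and for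
any such μ₀ the resulting allocation β(μ₀) is a maximizer of u₁(·, a₂) over A₁. -/
theorem stmt_8 (N : ℕ) (hN : 1 ≤ N)
    (ρ x₀ : Fin N → ℝ) (hρ : ∀ n, 0 < ρ n) (hx₀ : ∀ n, 0 < x₀ n ∧ x₀ n < 1)
    (γ₁ lam₁ : ℝ) (hγ₁ : 0 < γ₁) (hlam₁ : 0 < lam₁)
    (b₁ B₁ : ℝ) (hb₁ : 0 ≤ b₁) (hB₁ : b₁ ≤ B₁)
    (A₁ : Set (Fin N → ℝ))
    (hA₁ : A₁ = {a : Fin N → ℝ | (∀ n, 0 ≤ a n ∧ a n ≤ b₁) ∧ ∑ n, a n ≤ B₁})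
    (φ : ℝ → ℝ → ℝ → ℝ) (hφ : ∀ x a a', φ x a a' = (x + a) / (1 + a + a'))
    (u₁ : (Fin N → ℝ) → (Fin N → ℝ) → ℝ)
    (hu₁ : ∀ a₁ a₂, u₁ a₁ a₂ =
      γ₁ * ∑ n, ρ n * φ (x₀ n) (a₁ n) (a₂ n) - lam₁ * ∑ n, a₁ n)
    (a₂ : Fin N → ℝ) (ha₂ : ∀ n, 0 ≤ a₂ n)
    (β : ℝ → Fin N → ℝ)
    (hβ : ∀ μ₀ n, β μ₀ n =
      min b₁ (max 0
        (Real.sqrt (γ₁ * ρ n * (1 - x₀ n + a₂ n) / (μ₀ + lam₁)) - 1 - a₂ n))) :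
    (∃ μ₀ : ℝ, 0 ≤ μ₀ ∧ (∑ n, β μ₀ n ≤ B₁) ∧ μ₀ * ((∑ n, β μ₀ n) - B₁) = 0) ∧
    (∀ μ₀ : ℝ, 0 ≤ μ₀ → (∑ n, β μ₀ n ≤ B₁) → μ₀ * ((∑ n, β μ₀ n) - B₁) = 0 →
      β μ₀ ∈ A₁ ∧ ∀ a₁ ∈ A₁, u₁ a₁ a₂ ≤ u₁ (β μ₀) a₂) := by
  have hc : ∀ n, 0 ≤ γ₁ * ρ n * (1 - x₀ n + a₂ n) := fun n =>
    mul_nonneg (mul_pos hγ₁ (hρ n)).le (by linarith [(hx₀ n).2, ha₂ n])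
  constructor
  · have hM : 0 ≤ ∑ n, γ₁ * ρ n * (1 - x₀ n + a₂ n) := Finset.sum_nonneg fun n _ => hc n
    refine exists_complementary_slackness (f := fun μ => ∑ n, β μ n) hM ?_ ?_
    · simp only [hβ]
      refine continuousOn_finsetSum _ fun n _ => ?_
      have hq : ContinuousOn (fun μ => γ₁ * ρ n * (1 - x₀ n + a₂ n) / (μ + lam₁))
          (Set.Icc 0 (∑ n, γ₁ * ρ n * (1 - x₀ n + a₂ n))) :=
        continuousOn_const.div (by fun_prop) fun μ hμ => (add_pos_of_nonneg_of_pos hμ.1 hlam₁).ne'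
      exact continuousOn_const.inf
        (continuousOn_const.sup ((hq.sqrt.sub continuousOn_const).sub continuousOn_const))
    · refine (Finset.sum_nonpos fun n _ => ?_).trans (hb₁.trans hB₁)
      have hle := Finset.single_le_sum (fun i _ => hc i) (Finset.mem_univ n)
      have hs : √(γ₁ * ρ n * (1 - x₀ n + a₂ n) /
          ((∑ n, γ₁ * ρ n * (1 - x₀ n + a₂ n)) + lam₁)) ≤ 1 := by
        rw [Real.sqrt_le_one, div_le_one (by linarith)]
        linarith
      rw [hβ]
      exact (min_le_right _ _).trans (max_le le_rfl (by linarith [ha₂ n]))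
  · intro μ hμ hsum hcs
    subst hA₁
    refine ⟨⟨fun n => ?_, hsum⟩, fun a ha => ?_⟩
    · rw [hβ]
      exact ⟨le_min hb₁ (le_max_left _ _), min_le_left _ _⟩
    · have hterm := Finset.sum_le_sum fun n (_ : n ∈ Finset.univ) =>
        agent_utility_le_clamp (mul_pos hγ₁ (hρ n)).le (hx₀ n).2.le (ha₂ n)
          (add_pos_of_nonneg_of_pos hμ hlam₁) (ha.1 n).1 (ha.1 n).2
      simp only [← hβ, ← hφ] at hterm
      simp only [Finset.sum_sub_distrib, mul_assoc γ₁, ← Finset.mul_sum] at hterm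
      have hpen := mul_le_mul_of_nonneg_left ha.2 hμ
      rw [hu₁, hu₁]
      linarith
end

section
/- Assume λ₁ > 0, fix a₂ ∈ ℝ^N with a₂_n ≥ 0 for all n, fix μ₀ ≥ 0, and let (W₀, W₁, W₂) be a partition of {1, …, N}. Suppose β ∈ ℝ^N satisfies β_n = 0 for n ∈ W₀; β_n = b₁ for n ∈ W₁; β_n = √(γ₁ ρ_n (1 − x₀_n + a₂_n)/(μ₀ + λ₁)) − 1 − a₂_n with β_n ≥ 0 for n ∈ W₂; and ∑_{n=1}^N β_n = B₁. If W₂ ≠ ∅, then μ₀ = ( ∑_{n ∈ W₂} √(γ₁ ρ_n (1 − x₀_n + a₂_n)) / (B₁ − b₁|W₁| + |W₂| + ∑_{n ∈ W₂} a₂_n) )² − λ₁, where |W₁| and |W₂| denote cardinalities. (The paper's closed-form water-level formula for the Lagrange multiplier of the budget constraint.) -/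
/-- The paper's closed-form water-level formula for the Lagrange multiplier of
Firm 1's budget constraint. -/
theorem stmt_9 (N : ℕ) (hN : 1 ≤ N)
    (ρ x₀ : Fin N → ℝ) (hρ : ∀ n, 0 < ρ n) (hx₀ : ∀ n, 0 < x₀ n ∧ x₀ n < 1)
    (γ₁ lam₁ : ℝ) (hγ₁ : 0 < γ₁) (hlam₁ : 0 < lam₁)
    (b₁ B₁ : ℝ) (hb₁ : 0 ≤ b₁) (hB₁ : b₁ ≤ B₁)
    (a₂ : Fin N → ℝ) (ha₂ : ∀ n, 0 ≤ a₂ n)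
    (μ₀ : ℝ) (hμ₀ : 0 ≤ μ₀)
    (W₀ W₁ W₂ : Finset (Fin N))
    (hd01 : Disjoint W₀ W₁) (hd02 : Disjoint W₀ W₂) (hd12 : Disjoint W₁ W₂)
    (hcover : W₀ ∪ W₁ ∪ W₂ = Finset.univ)
    (β : Fin N → ℝ)
    (hβ0 : ∀ n ∈ W₀, β n = 0)
    (hβ1 : ∀ n ∈ W₁, β n = b₁)
    (hβ2 : ∀ n ∈ W₂, β n =
      Real.sqrt (γ₁ * ρ n * (1 - x₀ n + a₂ n) / (μ₀ + lam₁)) - 1 - a₂ n)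
    (hβ2nonneg : ∀ n ∈ W₂, 0 ≤ β n)
    (hsum : ∑ n, β n = B₁)
    (hW₂ : W₂.Nonempty) :
    μ₀ = ((∑ n ∈ W₂, Real.sqrt (γ₁ * ρ n * (1 - x₀ n + a₂ n))) /
        (B₁ - b₁ * W₁.card + W₂.card + ∑ n ∈ W₂, a₂ n)) ^ 2 - lam₁ := by
  have hpos : 0 < μ₀ + lam₁ := by linarith
  have hS : 0 < ∑ n ∈ W₂, Real.sqrt (γ₁ * ρ n * (1 - x₀ n + a₂ n)) := by
    refine Finset.sum_pos (fun n _ => Real.sqrt_pos.mpr ?_) hW₂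
    have h : 0 < 1 - x₀ n + a₂ n := by linarith [(hx₀ n).2, ha₂ n]
    exact mul_pos (mul_pos hγ₁ (hρ n)) h
  have hsplit : B₁ = b₁ * W₁.card + ∑ n ∈ W₂, β n := by
    rw [← hsum, ← hcover,
      Finset.sum_union (Finset.disjoint_union_left.mpr ⟨hd02, hd12⟩),
      Finset.sum_union hd01, Finset.sum_eq_zero hβ0, Finset.sum_congr rfl hβ1,
      Finset.sum_const, nsmul_eq_mul]
    ring
  have hβ : ∑ n ∈ W₂, β n =
      (∑ n ∈ W₂, Real.sqrt (γ₁ * ρ n * (1 - x₀ n + a₂ n))) / Real.sqrt (μ₀ + lam₁)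
        - W₂.card - ∑ n ∈ W₂, a₂ n := by
    simp only [Finset.sum_congr rfl hβ2, Real.sqrt_div' _ hpos.le, Finset.sum_sub_distrib,
      Finset.sum_div, Finset.sum_const, nsmul_eq_mul, mul_one]
  have hden : B₁ - b₁ * W₁.card + W₂.card + ∑ n ∈ W₂, a₂ n =
      (∑ n ∈ W₂, Real.sqrt (γ₁ * ρ n * (1 - x₀ n + a₂ n))) / Real.sqrt (μ₀ + lam₁) := by
    linarith
  rw [hden, div_div_cancel₀ hS.ne', Real.sq_sqrt hpos.le]
  ring
end

section
/- Let k₁, k₂ > 0, ρ_n > 0, x₀_n ∈ (0,1), and suppose a₁_n, a₂_n ≥ 0 satisfy the interior best-response fixed-point equations a₁_n = √(k₁ ρ_n (1 − x₀_n + a₂_n)) − 1 − a₂_n and a₂_n = √(k₂ ρ_n (x₀_n + a₁_n)) − 1 − a₁_n. Then a₁_n = (k₁/(k₁ + k₂))² k₂ ρ_n − x₀_n and a₂_n = (k₂/(k₁ + k₂))² k₁ ρ_n − (1 − x₀_n). (The interior-allocation case of the paper's Proposition 2, giving the Nash equilibrium in closed form.) -/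
/-- Positive solutions of `(u + v) ^ 2 = p * v = q * u` are unique, with explicit formulas. -/
theorem eq_of_sq_add_eq_mul {p q u v : ℝ} (hp : 0 < p) (hq : 0 < q) (hu : 0 < u) (hv : 0 < v)
    (h₁ : (u + v) ^ 2 = p * v) (h₂ : (u + v) ^ 2 = q * u) :
    u = p ^ 2 * q / (p + q) ^ 2 ∧ v = q ^ 2 * p / (p + q) ^ 2 := by
  have hpq : 0 < p + q := add_pos hp hq
  have hu' : (p + q) * u = p * (u + v) := by linarith
  have hv' : (p + q) * v = q * (u + v) := by linarith
  have hs : (p + q) * (u + v) = p * q := by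
    refine mul_right_cancel₀ (add_pos hu hv).ne' ?_
    linear_combination (p + q) * h₂ + q * hu'
  constructor
  · rw [eq_div_iff (by positivity)]
    linear_combination (p + q) * hu' + p * hs
  · rw [eq_div_iff (by positivity)]
    linear_combination (p + q) * hv' + q * hs

/-- Interior-allocation case of the paper's Proposition 2: the closed-form
Nash-equilibrium allocations on one agent. -/
theorem stmt_10 (k₁ k₂ ρ x₀ : ℝ) (hk₁ : 0 < k₁) (hk₂ : 0 < k₂) (hρ : 0 < ρ)
    (hx₀ : x₀ ∈ Set.Ioo (0 : ℝ) 1)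
    (a₁ a₂ : ℝ) (ha₁ : 0 ≤ a₁) (ha₂ : 0 ≤ a₂)
    (heq₁ : a₁ = Real.sqrt (k₁ * ρ * (1 - x₀ + a₂)) - 1 - a₂)
    (heq₂ : a₂ = Real.sqrt (k₂ * ρ * (x₀ + a₁)) - 1 - a₁) :
    a₁ = (k₁ / (k₁ + k₂)) ^ 2 * k₂ * ρ - x₀ ∧
    a₂ = (k₂ / (k₁ + k₂)) ^ 2 * k₁ * ρ - (1 - x₀) := by
  obtain ⟨hx, hx'⟩ := hx₀
  have hu : 0 < x₀ + a₁ := by linarith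
  have hv : 0 < 1 - x₀ + a₂ := by linarith
  have h₁ : (x₀ + a₁ + (1 - x₀ + a₂)) ^ 2 = k₁ * ρ * (1 - x₀ + a₂) := by
    rw [← Real.sq_sqrt (show 0 ≤ k₁ * ρ * (1 - x₀ + a₂) by positivity)]
    congr 1
    linarith
  have h₂ : (x₀ + a₁ + (1 - x₀ + a₂)) ^ 2 = k₂ * ρ * (x₀ + a₁) := by
    rw [← Real.sq_sqrt (show 0 ≤ k₂ * ρ * (x₀ + a₁) by positivity)]
    congr 1
    linarith
  obtain ⟨h₃, h₄⟩ := eq_of_sq_add_eq_mul (mul_pos hk₁ hρ) (mul_pos hk₂ hρ) hu hv h₁ h₂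
  constructor
  · rw [eq_sub_iff_add_eq', h₃]
    field_simp
  · rw [eq_sub_iff_add_eq', h₄]
    field_simp
end
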